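/- Let n ≥ 1, let A_H be a real 4n×4n matrix, and let A_K : [0,∞) → ℝ^{4n×4n} be continuous. Suppose Π^⊥·A_H·Π = 0 and Π^⊥·A_K(t)·Π = 0 for all t ≥ 0. Then every continuously differentiable x : [0,∞) → ℝ^{4n} satisfying x'(t) = A_H·x(t) + ∫₀^t A_K(t−τ)·x(τ) dτ for all t ≥ 0 and Π^⊥·x(0) = 0 also satisfies Π^⊥·x(t) = 0 for all t ≥ 0. -/

import Mathlib

open MeasureTheory Set

/-- The orthogonal projection `Π = (1/2)[[I,I],[I,I]]` onto `Ker(-I I)`. -/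
noncomputable def PiProj (n : ℕ) :
    Matrix (Fin (2*n) ⊕ Fin (2*n)) (Fin (2*n) ⊕ Fin (2*n)) ℝ :=
  (1/2 : ℝ) • Matrix.fromBlocks 1 1 1 1

/-- The complementary projection `Π^⊥ = (1/2)[[I,-I],[-I,I]]`. -/
noncomputable def PiPerp (n : ℕ) :
    Matrix (Fin (2*n) ⊕ Fin (2*n)) (Fin (2*n) ⊕ Fin (2*n)) ℝ :=
  (1/2 : ℝ) • Matrix.fromBlocks 1 (-1) (-1) 1

/-- A Grönwall inequality with memory: a function vanishing at `0` whose derivative is bounded by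
a multiple of its norm plus its accumulated norm vanishes. -/
theorem eq_zero_of_norm_deriv_le_add_integral {E : Type*} [NormedAddCommGroup E] [NormedSpace ℝ E]
    {y y' : ℝ → E} {T C D : ℝ} (hC : 0 ≤ C) (hD : 0 ≤ D)
    (hy : ∀ t ≥ (0 : ℝ), HasDerivWithinAt y (y' t) (Ici 0) t) (hy0 : y 0 = 0)
    (hbound : ∀ t ∈ Ico 0 T, ‖y' t‖ ≤ C * ‖y t‖ + D * ∫ τ in (0 : ℝ)..t, ‖y τ‖) :
    ∀ t ∈ Icc 0 T, y t = 0 := by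
  have hycont : ContinuousOn y (Ici 0) := fun t ht => (hy t ht).continuousWithinAt
  have hw : ∀ t ≥ (0 : ℝ),
      HasDerivWithinAt (fun s => ∫ τ in (0 : ℝ)..s, ‖y τ‖) ‖y t‖ (Ici t) t := by
    intro t ht
    have hsub : Ici t ⊆ Ici 0 := Ici_subset_Ici.2 ht
    refine intervalIntegral.integral_hasDerivWithinAt_right ?_ (t := Ioi t) ?_ ?_
    · apply ContinuousOn.intervalIntegrable
      rw [uIcc_of_le ht]
      exact hycont.norm.mono Icc_subset_Ici_self
    · exact (hycont.norm.mono (Ioi_subset_Ici_self.trans hsub)).stronglyMeasurableAtFilter_nhdsWithin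
        measurableSet_Ioi t
    · exact (hycont.norm t ht).mono (Ioi_subset_Ici_self.trans hsub)
  have hwcont : ContinuousOn (fun s => ∫ τ in (0 : ℝ)..s, ‖y τ‖) (Icc 0 T) := by
    by_cases hT : 0 ≤ T
    · rw [← uIcc_of_le hT]
      apply intervalIntegral.continuousOn_primitive_interval
      rw [uIcc_of_le hT]
      exact (hycont.norm.mono Icc_subset_Ici_self).integrableOn_Icc
    · simp [Icc_eq_empty hT]
  intro t ht
  have hz := norm_le_gronwallBound_of_norm_deriv_right_le (E := E × ℝ)
    (f := fun s => (y s, ∫ τ in (0 : ℝ)..s, ‖y τ‖)) (f' := fun s => (y' s, ‖y s‖))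
    (δ := 0) (K := C + D + 1) (ε := 0) (a := 0) (b := T)
    ((hycont.mono Icc_subset_Ici_self).prodMk hwcont)
    (fun s hs => ((hy s hs.1).mono (Ici_subset_Ici.2 hs.1)).prodMk (hw s hs.1))
    (by simp [hy0])
    (by
      intro s hs
      have h₁ := norm_fst_le (y s, ∫ τ in (0 : ℝ)..s, ‖y τ‖)
      have h₂ := (le_abs_self _).trans (norm_snd_le (y s, ∫ τ in (0 : ℝ)..s, ‖y τ‖))
      have h₃ := hbound s hs
      dsimp only at h₁ h₂
      set N := ‖(y s, ∫ τ in (0 : ℝ)..s, ‖y τ‖)‖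
      have hN : 0 ≤ N := norm_nonneg _
      have h₄ := mul_le_mul_of_nonneg_left h₁ hC
      have h₅ := mul_le_mul_of_nonneg_left h₂ hD
      rw [Prod.norm_def, max_le_iff, norm_norm]
      constructor
      · dsimp only
        linarith
      · have := mul_nonneg hC hN
        have := mul_nonneg hD hN
        linarith)
    t ht
  rw [gronwallBound_ε0_δ0] at hz
  exact norm_le_zero_iff.1 ((norm_fst_le _).trans hz)

theorem PiProj_add_PiPerp (n : ℕ) : PiProj n + PiPerp n = 1 := by
  rw [PiProj, PiPerp, ← smul_add, Matrix.fromBlocks_add, ← Matrix.fromBlocks_one]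
  simp only [add_neg_cancel, Matrix.fromBlocks_smul, smul_zero, ← two_smul ℝ (1 : Matrix _ _ ℝ),
    smul_smul]
  norm_num

theorem PiPerp_mulVec_mulVec {n : ℕ}
    {A : Matrix (Fin (2*n) ⊕ Fin (2*n)) (Fin (2*n) ⊕ Fin (2*n)) ℝ}
    (hA : PiPerp n * A * PiProj n = 0) (v : (Fin (2*n) ⊕ Fin (2*n)) → ℝ) :
    (PiPerp n).mulVec (A.mulVec v) = (PiPerp n * A).mulVec ((PiPerp n).mulVec v) := by
  have h : PiPerp n * A = PiPerp n * A * PiPerp n := by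
    conv_lhs => rw [← mul_one (PiPerp n * A), ← PiProj_add_PiPerp n, mul_add, hA, zero_add]
  rw [Matrix.mulVec_mulVec, Matrix.mulVec_mulVec, ← h]

section

attribute [local instance] Matrix.linftyOpNormedAddCommGroup

/-- Matrices depending continuously on a parameter in a compact set are uniformly bounded. -/
theorem exists_norm_mulVec_le {ι : Type*} [Fintype ι] {X : Type*} [TopologicalSpace X]
    {A : X → Matrix ι ι ℝ} {s : Set X} (hs : IsCompact s) (hA : ContinuousOn A s) :
    ∃ C, 0 ≤ C ∧ ∀ t ∈ s, ∀ v, ‖(A t).mulVec v‖ ≤ C * ‖v‖ := by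
  obtain ⟨C, hC⟩ := hs.exists_bound_of_continuousOn hA
  refine ⟨max C 0, le_max_right _ _, fun t ht v => ?_⟩
  exact (Matrix.linfty_opNorm_mulVec _ _).trans
    (mul_le_mul_of_nonneg_right ((hC t ht).trans (le_max_left _ _)) (norm_nonneg _))

end

theorem stmt_7 {n : ℕ} (hn : 1 ≤ n)
    (AH : Matrix (Fin (2*n) ⊕ Fin (2*n)) (Fin (2*n) ⊕ Fin (2*n)) ℝ)
    (AK : ℝ → Matrix (Fin (2*n) ⊕ Fin (2*n)) (Fin (2*n) ⊕ Fin (2*n)) ℝ)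
    (hAKcont : ContinuousOn AK (Set.Ici 0))
    (hAH : PiPerp n * AH * PiProj n = 0)
    (hAK : ∀ t ≥ (0:ℝ), PiPerp n * AK t * PiProj n = 0)
    (x : ℝ → (Fin (2*n) ⊕ Fin (2*n)) → ℝ)
    (hx : ∀ t ≥ (0:ℝ), HasDerivWithinAt x
      (AH.mulVec (x t) + ∫ τ in Set.Icc (0:ℝ) t, (AK (t - τ)).mulVec (x τ)) (Set.Ici 0) t)
    (hx0 : (PiPerp n).mulVec (x 0) = 0) :
    ∀ t ≥ (0:ℝ), (PiPerp n).mulVec (x t) = 0 := by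
  intro T hT
  have hxcont : ContinuousOn x (Ici 0) := fun t ht => (hx t ht).continuousWithinAt
  let P := LinearMap.toContinuousLinearMap (Matrix.mulVecLin (PiPerp n))
  have hP : ∀ v, P v = (PiPerp n).mulVec v := fun _ => rfl
  obtain ⟨C, hC, hCbound⟩ := exists_norm_mulVec_le (isCompact_singleton (x := (0 : ℝ)))
    (continuousOn_const (c := PiPerp n * AH))
  obtain ⟨D, hD, hDbound⟩ := exists_norm_mulVec_le (isCompact_Icc (a := (0 : ℝ)) (b := T))
    ((continuousOn_const (c := PiPerp n)).mul (hAKcont.mono Icc_subset_Ici_self))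
  refine eq_zero_of_norm_deriv_le_add_integral (y := fun t => P (x t)) hC hD
    (fun t ht => P.hasFDerivAt.comp_hasDerivWithinAt t (hx t ht)) hx0 ?_ T ⟨hT, le_rfl⟩
  intro t ht
  have hint : IntegrableOn (fun τ => (AK (t - τ)).mulVec (x τ)) (Icc 0 t) := by
    refine ContinuousOn.integrableOn_Icc ?_
    have hA : ContinuousOn (fun τ => AK (t - τ)) (Icc 0 t) :=
      hAKcont.comp (by fun_prop) fun τ hτ => sub_nonneg.2 hτ.2
    have hv : ContinuousOn x (Icc 0 t) := hxcont.mono Icc_subset_Ici_self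
    rw [continuousOn_iff_continuous_domRestrict] at hA hv ⊢
    exact hA.matrix_mulVec hv
  rw [map_add, ← P.integral_comp_comm hint]
  refine (norm_add_le _ _).trans (add_le_add ?_ ?_)
  · rw [hP, PiPerp_mulVec_mulVec hAH]
    exact hCbound 0 rfl _
  · rw [intervalIntegral.integral_of_le ht.1, ← integral_Icc_eq_integral_Ioc,
      ← integral_const_mul]
    refine norm_integral_le_of_norm_le ?_ ?_
    · exact (continuousOn_const.mul (P.continuous.comp_continuousOn
        (hxcont.mono Icc_subset_Ici_self)).norm).integrableOn_Icc
    · refine (ae_restrict_iff' measurableSet_Icc).2 (Filter.Eventually.of_forall fun τ hτ => ?_)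
      rw [hP, PiPerp_mulVec_mulVec (hAK _ (sub_nonneg.2 hτ.2))]
      exact hDbound (t - τ) ⟨sub_nonneg.2 hτ.2, by linarith [hτ.1, ht.2]⟩ _
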